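/- Let G be an amenable group with a Følner net F, let X be an irreducible algebraic variety over an algebraically closed field K, let A := X(K), and let τ : A^G → A^G be an algebraic cellular automaton over (G,X,K). If mdim_F(τ(A^G)) = dim(X), then τ is (*)-pre-injective. -/

import Mathlib

open AlgebraicGeometry CategoryTheory CategoryTheory.Limits Filter Topology
open scoped ENNReal NNReal

noncomputable section

namespace GOE

/-! ## Følner nets and amenability -/

/-- A (right) Følner net for a group `G`: a net of nonempty finite subsets `F i ⊆ G`,
indexed by a directed nonempty preorder, such that `|F i \ F i g| / |F i| → 0` for every
`g ∈ G`. -/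
structure FolnerNet (G : Type) [Group G] where
  ι : Type
  [pre : Preorder ι]
  [ne : Nonempty ι]
  [dir : IsDirected ι (· ≤ ·)]
  F : ι → Finset G
  nonempty : ∀ i, (F i).Nonempty
  folner : ∀ g : G,
    Filter.Tendsto
      (fun i => ((((F i : Set G) \ ((· * g) '' (F i : Set G))).ncard : ℝ) / ((F i).card : ℝ)))
      Filter.atTop (nhds 0)

attribute [instance] FolnerNet.pre FolnerNet.ne FolnerNet.dir

/-- A group is amenable if it admits a Følner net. -/
def Amenable (G : Type) [Group G] : Prop := Nonempty (FolnerNet G)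

/-! ## Constructible subsets of a topological space -/

/-- A subset of a topological space is constructible if it is a finite union of
locally closed subsets. -/
def IsConstr {X : Type} [TopologicalSpace X] (C : Set X) : Prop :=
  ∃ (n : ℕ) (U Z : Fin n → Set X), (∀ i, IsOpen (U i)) ∧ (∀ i, IsClosed (Z i)) ∧
    C = ⋃ i, U i ∩ Z i

/-- Conversion of a Krull dimension (an element of `WithBot ℕ∞`) to an extended real. -/
def dimE (d : WithBot ℕ∞) : EReal :=
  WithBot.recBotCoe ⊥ (fun n : ℕ∞ => ((n : ℝ≥0∞) : EReal)) d

/-! ## Varieties over a field and their points -/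

variable (K : Type) [Field K]

/-- The spectrum of the field `K`, as a scheme. -/
abbrev SpecK : Scheme := Spec (CommRingCat.of K)

/-- The unique point of `Spec K`. -/
def specPt : SpecK K := (⟨⊥, Ideal.bot_prime⟩ : PrimeSpectrum K)

instance : HasFiniteProducts (Over (SpecK K)) :=
  CategoryTheory.Over.ConstructProducts.over_finiteProducts_of_finiteWidePullbacks

/-- The set of `K`-points of a `K`-scheme, i.e. sections of the structure morphism,
i.e. morphisms `Spec K ⟶ X` over `Spec K`. -/
abbrev Pt (W : Over (SpecK K)) : Type := Over.mk (𝟙 (SpecK K)) ⟶ W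

/-- The image in (the underlying space of) `W` of a `K`-point of `W`. -/
def ev {W : Over (SpecK K)} (a : Pt K W) : W.left := a.left.base (specPt K)

/-- The fibered power `X^Ω` over `Spec K` of a `K`-scheme `X`, for a finite index set `Ω`. -/
def pow (V : Over (SpecK K)) (Ω : Type) [Finite Ω] : Over (SpecK K) :=
  ∏ᶜ (fun _ : Ω => V)

/-- The canonical identification of families of `K`-points indexed by `Ω` with
`K`-points of the fibered power `X^Ω`. -/
def ptPow (V : Over (SpecK K)) (Ω : Type) [Finite Ω] (a : Ω → Pt K V) :
    Pt K (pow K V Ω) := Pi.lift a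

variable (V : Over (SpecK K))

/-- The Krull dimension of (the underlying space of) a `K`-scheme. -/
def vdim : WithBot ℕ∞ := topologicalKrullDim V.left

/-- The Zariski topology on `A^Ω` (`A` the set of `K`-points of `X`), induced from the
Zariski topology of the fibered power `X^Ω` via the identification of `A^Ω` with a
subset (the set of closed points, for `K` algebraically closed) of `X^Ω`. -/
def cfgTop (Ω : Type) [Finite Ω] : TopologicalSpace (Ω → Pt K V) :=
  TopologicalSpace.induced (fun u => ev K (ptPow K V Ω u)) inferInstance

/-- The Krull dimension of a subset `D ⊆ A^Ω` for the Zariski topology. -/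
def cfgDim (Ω : Type) [Finite Ω] (D : Set (Ω → Pt K V)) : WithBot ℕ∞ :=
  letI := cfgTop K V Ω
  topologicalKrullDim D

/-- `D ⊆ A^Ω` is closed for the Zariski topology. -/
def cfgClosed (Ω : Type) [Finite Ω] (D : Set (Ω → Pt K V)) : Prop :=
  letI := cfgTop K V Ω
  IsClosed D

/-- `D ⊆ A^Ω` is constructible for the Zariski topology. -/
def cfgConstr (Ω : Type) [Finite Ω] (D : Set (Ω → Pt K V)) : Prop :=
  letI := cfgTop K V Ω
  IsConstr D

/-! ## Configurations, restrictions, cylinders -/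

variable {G : Type} [Group G]

/-- The restriction `Γ_Ω ⊆ A^Ω` of a set of configurations `Γ ⊆ A^G`. -/
def restr (Γ : Set (G → Pt K V)) (Ω : Finset G) : Set (↥Ω → Pt K V) :=
  (fun c (ω : ↥Ω) => c ω) '' Γ

/-- The cylinder `D_p ⊆ A^G`: configurations restricting to an element of `D` on `Ω` and
to `p` on `G ∖ Ω`. -/
def cyl (Ω : Finset G) (D : Set (↥Ω → Pt K V)) (p : {g : G // g ∉ Ω} → Pt K V) :
    Set (G → Pt K V) :=
  {c | (fun ω : ↥Ω => c ω) ∈ D ∧ ∀ (g : G) (h : g ∉ Ω), c g = p ⟨g, h⟩}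

/-- Algebraic mean dimension of `Γ ⊆ A^G` with respect to a Følner net. -/
def mdim (𝓕 : FolnerNet G) (Γ : Set (G → Pt K V)) : EReal :=
  Filter.limsup
    (fun i => dimE (cfgDim K V ↥(𝓕.F i) (restr K V Γ (𝓕.F i))) *
      ((((𝓕.F i).card : ℝ)⁻¹ : ℝ) : EReal))
    Filter.atTop

/-! ## Cellular automata -/

/-- `τ : A^G → A^G` is an algebraic cellular automaton over `(G, X, K)`: it admits a finite
memory set `M ⊆ G` whose associated local defining map `A^M → A` is induced by a morphism
of `K`-schemes `f : X^M → X`. -/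
def IsAlgCA (τ : (G → Pt K V) → (G → Pt K V)) : Prop :=
  ∃ (M : Finset G) (f : pow K V ↥M ⟶ V),
    ∀ (x : G → Pt K V) (g : G),
      τ x g = ptPow K V ↥M (fun m => x (g * (m : G))) ≫ f

/-- Pre-injectivity: configurations that are almost equal and have the same image are equal. -/
def PreInjective (τ : (G → Pt K V) → (G → Pt K V)) : Prop :=
  ∀ c₁ c₂ : G → Pt K V, {g : G | c₁ g ≠ c₂ g}.Finite → τ c₁ = τ c₂ → c₁ = c₂

/-- `(*)`-pre-injectivity: there exist no finite subset `Ω ⊆ G` and Zariski-closed proper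
subset `H ⊊ A^Ω` such that `τ((A^Ω)_p) = τ(H_p)` for all `p ∈ A^{G∖Ω}`. -/
def StarPreInjective (τ : (G → Pt K V) → (G → Pt K V)) : Prop :=
  ¬ ∃ (Ω : Finset G) (H : Set (↥Ω → Pt K V)), cfgClosed K V ↥Ω H ∧ H ≠ Set.univ ∧
      ∀ p : {g : G // g ∉ Ω} → Pt K V,
        τ '' cyl K V Ω Set.univ p = τ '' cyl K V Ω H p

/-- `(**)`-pre-injectivity: there is no finite subset `Ω ⊆ G` such that, for every
`p ∈ A^{G∖Ω}`, the finite-support set `τ((A^Ω)_p)` (written as some `R_s`) satisfies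
`dim(R) < dim(A^Ω)`. -/
def StarStarPreInjective (τ : (G → Pt K V) → (G → Pt K V)) : Prop :=
  ¬ ∃ Ω : Finset G, ∀ p : {g : G // g ∉ Ω} → Pt K V,
      ∃ (Λ : Finset G) (R : Set (↥Λ → Pt K V)) (s : {g : G // g ∉ Λ} → Pt K V),
        τ '' cyl K V Ω Set.univ p = cyl K V Λ R s ∧
        cfgDim K V ↥Λ R < cfgDim K V ↥Ω (Set.univ : Set (↥Ω → Pt K V))

/-- `Γ ⊆ A^G` is closed for the prodiscrete topology on `A^G`. -/
def ProdiscreteClosed {A : Type} (Γ : Set (G → A)) : Prop :=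
  letI : TopologicalSpace A := ⊥
  IsClosed Γ

/-- `Γ ⊆ A^G` is invariant under the shift action of `G`. -/
def ShiftInvariant {A : Type} (Γ : Set (G → A)) : Prop :=
  ∀ (g : G), ∀ c ∈ Γ, (fun h : G => c (g⁻¹ * h)) ∈ Γ

/-- An `(E,E')`-tiling of `G`. -/
def IsTiling (E E' : Finset G) (T : Set G) : Prop :=
  (∀ g ∈ T, ∀ h ∈ T, g ≠ h →
    Disjoint ((g * ·) '' (E : Set G)) ((h * ·) '' (E : Set G))) ∧
  ∀ x : G, ∃ g ∈ T, x ∈ (g * ·) '' (E' : Set G)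

open Cardinal in
theorem trdeg_quotient_lt {K A : Type} [Field K] [CommRing A] [IsDomain A] [Algebra K A]
    (hfin : Algebra.trdeg K A < ℵ₀) (q : Ideal A) [q.IsPrime] (hq : q ≠ ⊥) :
    Algebra.trdeg K (A ⧸ q) < Algebra.trdeg K A := by
  refine lt_of_le_of_ne
    (trdeg_le_of_surjective (Ideal.Quotient.mkₐ K q) Ideal.Quotient.mk_surjective) fun h ↦ ?_
  have : FaithfulSMul K (A ⧸ q) :=
    (faithfulSMul_iff_algebraMap_injective _ _).mpr (algebraMap K (A ⧸ q)).injective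
  obtain ⟨s, hs⟩ := exists_isTranscendenceBasis K (A ⧸ q)
  let a : s → A := fun i ↦ Function.surjInv Ideal.Quotient.mk_surjective (i : A ⧸ q)
  have ha : ∀ i, Ideal.Quotient.mkₐ K q (a i) = i := fun i ↦
    Function.surjInv_eq Ideal.Quotient.mk_surjective (i : A ⧸ q)
  have hcomp : (Ideal.Quotient.mkₐ K q) ∘ a = ((↑) : s → A ⧸ q) := funext ha
  have hind : AlgebraicIndependent K a :=
    AlgebraicIndependent.of_comp (Ideal.Quotient.mkₐ K q) (hcomp ▸ hs.1)
  have hb : IsTranscendenceBasis K a :=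
    hind.isTranscendenceBasis_of_trdeg_le hfin (by rw [← h, hs.cardinalMk_eq_trdeg])
  have halg := hb.isAlgebraic
  obtain ⟨x, hx, hx0⟩ := Submodule.exists_mem_ne_zero_of_ne_bot hq
  apply Ideal.comap_ne_bot_of_algebraic_mem hx0 hx (halg.isAlgebraic x)
  rw [eq_bot_iff]
  rintro ⟨z, hz⟩ hzq
  obtain ⟨p, rfl⟩ : ∃ p, MvPolynomial.aeval a p = z := by
    rw [Algebra.adjoin_range_eq_range_aeval] at hz
    exact hz
  have h0 : MvPolynomial.aeval ((↑) : s → A ⧸ q) p = 0 := by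
    rw [← hcomp]
    refine (MvPolynomial.comp_aeval_apply a (Ideal.Quotient.mkₐ K q) p).symm.trans ?_
    exact Ideal.Quotient.eq_zero_iff_mem.mpr hzq
  have hp : p = 0 := hs.1.eq_zero_of_aeval_eq_zero _ h0
  exact Subtype.ext (by simp [hp])

theorem trdeg_le_ringKrullDim (K : Type) {A : Type} [Field K] [CommRing A] [IsDomain A]
    [Algebra K A] [Algebra.FiniteType K A] :
    ((Cardinal.toNat (Algebra.trdeg K A) : ℕ) : WithBot ℕ∞) ≤ ringKrullDim A := by
  obtain ⟨s, g, hinj, hint⟩ := exists_integral_inj_algHom_of_fg K A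
  algebraize [g.toRingHom]
  have hI : Algebra.IsIntegral (MvPolynomial (Fin s) K) A := ⟨hint⟩
  have : FaithfulSMul (MvPolynomial (Fin s) K) A :=
    (faithfulSMul_iff_algebraMap_injective _ _).mpr hinj
  have : IsScalarTower K (MvPolynomial (Fin s) K) A := IsScalarTower.of_algebraMap_eq fun x ↦ by
    exact (g.commutes x).symm
  have h1 : Algebra.trdeg K A = s := by
    rw [← trdeg_add_eq K (MvPolynomial (Fin s) K), trdeg_eq_zero (R := MvPolynomial (Fin s) K)]
    simp
  rw [h1, Cardinal.toNat_natCast]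
  have h2 : ringKrullDim (MvPolynomial (Fin s) K) = s := by
    simp
  rw [← h2]
  refine iSup_le fun l ↦ ?_
  obtain ⟨P, hP1, hP, hP2⟩ := Ideal.exists_ideal_over_prime_of_isIntegral l.head.asIdeal
    (⊥ : Ideal A) ((Ideal.comap_bot_of_injective (algebraMap (MvPolynomial (Fin s) K) A)
      hinj).le.trans bot_le)
  have : P.LiesOver l.head.asIdeal := ⟨hP2.symm⟩
  have : Algebra.HasGoingUp (MvPolynomial (Fin s) K) A := inferInstance
  obtain ⟨L, hL, -⟩ := Ideal.exists_ltSeries_of_hasGoingUp l P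
  rw [← hL]
  exact le_iSup (fun p : LTSeries (PrimeSpectrum A) ↦ (p.length : WithBot ℕ∞)) L

/-- The transcendence degree of a ring homomorphism. -/
def ringTrdeg {R S : Type} [CommRing R] [CommRing S] (φ : R →+* S) : Cardinal :=
  letI := φ.toAlgebra
  Algebra.trdeg R S

theorem ringTrdeg_le_comp {R S T : Type} [CommRing R] [CommRing S] [CommRing T] (φ : R →+* S)
    (ψ : S →+* T) (hψ : Function.Injective ψ) : ringTrdeg φ ≤ ringTrdeg (ψ.comp φ) := by
  let := φ.toAlgebra
  let := (ψ.comp φ).toAlgebra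
  exact trdeg_le_of_injective (R := R) (A := S) (A' := T) ⟨ψ, fun _ ↦ rfl⟩ hψ

theorem ringTrdeg_comp_of_bijective {R S T : Type} [CommRing R] [CommRing S] [CommRing T]
    (φ : R →+* S) (ψ : S →+* T) (hψ : Function.Bijective ψ) :
    ringTrdeg (ψ.comp φ) = ringTrdeg φ := by
  refine le_antisymm ?_ (ringTrdeg_le_comp φ ψ hψ.1)
  let e := RingEquiv.ofBijective ψ hψ
  have := ringTrdeg_le_comp (ψ.comp φ) (e.symm : T →+* S) e.symm.injective
  rwa [← RingHom.comp_assoc, show (e.symm : T →+* S).comp ψ = RingHom.id S from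
    RingHom.ext fun x ↦ e.symm_apply_apply x, RingHom.id_comp] at this

variable {K}

/-- The structure homomorphism from the ground field to the residue field at a point. -/
def ptHom {Y : Scheme} (f : Y ⟶ SpecK K) (y : Y) : K →+* Y.residueField y :=
  (Spec.preimage (Y.fromSpecResidueField y ≫ f)).hom

/-- The transcendence degree of the residue field at a point over the ground field. -/
def ptRank {Y : Scheme} (f : Y ⟶ SpecK K) (y : Y) : Cardinal := ringTrdeg (ptHom f y)

theorem specMap_ptHom {Y : Scheme} (f : Y ⟶ SpecK K) (y : Y) :
    Spec.map (CommRingCat.ofHom (ptHom f y)) = Y.fromSpecResidueField y ≫ f :=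
  Spec.map_preimage _

theorem ptHom_eq_of_specMap {Y : Scheme} (f : Y ⟶ SpecK K) (y : Y) (φ : K →+* Y.residueField y)
    (h : Spec.map (CommRingCat.ofHom φ) = Y.fromSpecResidueField y ≫ f) : ptHom f y = φ := by
  rw [← specMap_ptHom] at h
  exact congrArg CommRingCat.Hom.hom (Spec.map_injective h.symm)

theorem ptHom_comp {Y Y' : Scheme} (φ : Y ⟶ Y') (f : Y' ⟶ SpecK K) (y : Y) :
    ptHom (φ ≫ f) y = (φ.residueFieldMap y).hom.comp (ptHom f (φ y)) := by
  apply ptHom_eq_of_specMap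
  rw [CommRingCat.ofHom_comp, Spec.map_comp, specMap_ptHom, CommRingCat.ofHom_hom,
    Scheme.Hom.SpecMap_residueFieldMap_fromSpecResidueField_assoc]

theorem ptRank_map_le {Y Y' : Scheme} (φ : Y ⟶ Y') (f : Y' ⟶ SpecK K) (y : Y) :
    ptRank f (φ y) ≤ ptRank (φ ≫ f) y := by
  rw [ptRank, ptRank, ptHom_comp]
  exact ringTrdeg_le_comp _ _ (φ.residueFieldMap y).hom.injective

theorem ptRank_map_of_isOpenImmersion {Y Y' : Scheme} (φ : Y ⟶ Y') [IsOpenImmersion φ]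
    (f : Y' ⟶ SpecK K) (y : Y) :
    ptRank f (φ y) = ptRank (φ ≫ f) y := by
  rw [ptRank, ptRank, ptHom_comp]
  refine (ringTrdeg_comp_of_bijective _ _ ?_).symm
  exact ConcreteCategory.bijective_of_isIso (φ.residueFieldMap y)

theorem ptRank_spec {A : CommRingCat.{0}} (φ : CommRingCat.of K ⟶ A) (p : Spec A) :
    letI := φ.hom.toAlgebra
    ptRank (Spec.map φ) p = Algebra.trdeg K (A ⧸ p.asIdeal) := by
  let := φ.hom.toAlgebra
  have hp : p.asIdeal.IsPrime := PrimeSpectrum.isPrime p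
  have h1 : ptHom (Spec.map φ) p = (Scheme.Spec.residueFieldIso A p).inv.hom.comp
      (algebraMap K p.asIdeal.ResidueField) := by
    apply ptHom_eq_of_specMap
    rw [← Scheme.Spec.map_residueFieldIso_inv_eq_fromSpecResidueField, Category.assoc,
      ← Spec.map_comp, ← Spec.map_comp]
    rfl
  rw [ptRank, h1, ringTrdeg_comp_of_bijective _ _
    (ConcreteCategory.bijective_of_isIso (Scheme.Spec.residueFieldIso A p).inv)]
  have h2 : ringTrdeg (algebraMap K p.asIdeal.ResidueField) =
      Algebra.trdeg K p.asIdeal.ResidueField := by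
    rw [ringTrdeg]
    congr 1
  rw [h2]
  have : FaithfulSMul K (A ⧸ p.asIdeal) :=
    (faithfulSMul_iff_algebraMap_injective _ _).mpr (algebraMap K (A ⧸ p.asIdeal)).injective
  have : FaithfulSMul (A ⧸ p.asIdeal) p.asIdeal.ResidueField :=
    (faithfulSMul_iff_algebraMap_injective _ _).mpr
      (IsFractionRing.injective (A ⧸ p.asIdeal) p.asIdeal.ResidueField)
  have : Algebra.IsAlgebraic (A ⧸ p.asIdeal) p.asIdeal.ResidueField :=
    IsLocalization.isAlgebraic _ (nonZeroDivisors (A ⧸ p.asIdeal))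
  rw [← trdeg_add_eq K (A ⧸ p.asIdeal),
    trdeg_eq_zero (R := A ⧸ p.asIdeal) (A := p.asIdeal.ResidueField), add_zero]

theorem exists_affine_chart {Y : Scheme} (f : Y ⟶ SpecK K) [LocallyOfFiniteType f] (y : Y) :
    ∃ (A : CommRingCat.{0}) (φ : CommRingCat.of K ⟶ A) (i : Spec A ⟶ Y),
      IsOpenImmersion i ∧ i ≫ f = Spec.map φ ∧ φ.hom.FiniteType ∧ y ∈ Set.range i := by
  obtain ⟨A, i, hi, hy, -⟩ := Y.exists_affine_mem_range_and_range_subset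
    (x := y) (U := ⊤) trivial
  refine ⟨A, Spec.preimage (i ≫ f), i, hi, (Spec.map_preimage _).symm, ?_, hy⟩
  rw [← HasRingHomProperty.Spec_iff (P := @LocallyOfFiniteType), Spec.map_preimage]
  infer_instance

theorem ptRank_lt_aleph0 {Y : Scheme} (f : Y ⟶ SpecK K) [LocallyOfFiniteType f] (y : Y) :
    ptRank f y < Cardinal.aleph0 := by
  obtain ⟨A, φ, i, hi, hif, hφ, p, rfl⟩ := exists_affine_chart f y
  rw [ptRank_map_of_isOpenImmersion, hif, ptRank_spec]
  let := φ.hom.toAlgebra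
  have : Algebra.FiniteType K A := hφ
  have : p.asIdeal.IsPrime := PrimeSpectrum.isPrime p
  exact trdeg_lt_aleph0_of_finiteType

theorem ptRank_lt_of_specializes {Y : Scheme} (f : Y ⟶ SpecK K) [LocallyOfFiniteType f] {y y' : Y}
    (h : y ⤳ y') (hne : y ≠ y') : ptRank f y' < ptRank f y := by
  obtain ⟨A, φ, i, hi, hif, hφ, p', rfl⟩ := exists_affine_chart f y'
  obtain ⟨p, rfl⟩ : y ∈ Set.range i :=
    h.mem_open i.isOpenEmbedding.isOpen_range ⟨p', rfl⟩
  have hp : p ⤳ p' := i.isOpenEmbedding.isInducing.specializes_iff.mp h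
  have hpp : p ≠ p' := fun h ↦ hne (congrArg _ h)
  rw [ptRank_map_of_isOpenImmersion, ptRank_map_of_isOpenImmersion, hif, ptRank_spec, ptRank_spec]
  let := φ.hom.toAlgebra
  have : Algebra.FiniteType K A := hφ
  have h1 : p.asIdeal.IsPrime := PrimeSpectrum.isPrime p
  have h2 : p'.asIdeal.IsPrime := PrimeSpectrum.isPrime p'
  have hle : p.asIdeal ≤ p'.asIdeal := (PrimeSpectrum.le_iff_specializes p p').mpr hp
  have hlt : ¬ p'.asIdeal ≤ p.asIdeal := fun h' ↦
    hpp (PrimeSpectrum.ext (le_antisymm hle h'))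
  let q := p'.asIdeal.map (Ideal.Quotient.mkₐ K p.asIdeal)
  have hker : RingHom.ker (Ideal.Quotient.mkₐ K p.asIdeal) ≤ p'.asIdeal :=
    fun x hx ↦ hle (Ideal.Quotient.eq_zero_iff_mem.mp hx)
  have hq : q.IsPrime := Ideal.map_isPrime_of_surjective Ideal.Quotient.mk_surjective hker
  have hq0 : q ≠ ⊥ := fun h0 ↦ hlt <| by
    intro x hx
    have : Ideal.Quotient.mkₐ K p.asIdeal x ∈ q := Ideal.mem_map_of_mem _ hx
    rw [h0] at this
    exact Ideal.Quotient.eq_zero_iff_mem.mp this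
  have := trdeg_quotient_lt (K := K) trdeg_lt_aleph0_of_finiteType q hq0
  rwa [AlgEquiv.trdeg_eq (DoubleQuot.quotQuotEquivQuotOfLEₐ K hle)] at this

theorem ptRank_le_of_specializes {Y : Scheme} (f : Y ⟶ SpecK K) [LocallyOfFiniteType f] {y y' : Y}
    (h : y ⤳ y') : ptRank f y' ≤ ptRank f y := by
  by_cases hne : y = y'
  · rw [hne]
  · exact (ptRank_lt_of_specializes f h hne).le

theorem ptRank_le_topologicalKrullDim {Y : Scheme} (f : Y ⟶ SpecK K) [LocallyOfFiniteType f]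
    (y : Y) : ((Cardinal.toNat (ptRank f y) : ℕ) : WithBot ℕ∞) ≤ topologicalKrullDim Y := by
  obtain ⟨A, φ, i, hi, hif, hφ, p, rfl⟩ := exists_affine_chart f y
  rw [ptRank_map_of_isOpenImmersion, hif, ptRank_spec]
  let := φ.hom.toAlgebra
  have : Algebra.FiniteType K A := hφ
  have : p.asIdeal.IsPrime := PrimeSpectrum.isPrime p
  calc _ ≤ ringKrullDim (A ⧸ p.asIdeal) := trdeg_le_ringKrullDim K
    _ ≤ ringKrullDim A := ringKrullDim_quotient_le _
    _ = topologicalKrullDim (PrimeSpectrum A) :=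
      (PrimeSpectrum.topologicalKrullDim_eq_ringKrullDim A).symm
    _ ≤ topologicalKrullDim Y := i.isOpenEmbedding.isInducing.topologicalKrullDim_le

theorem exists_subfield_ringTrdeg_le {I : Type} {κ : Type} [Field κ] (σ : K →+* κ)
    (E : I → Type) [∀ i, Field (E i)] (σ' : ∀ i, K →+* E i) (ρ : ∀ i, E i →+* κ)
    (hρ : ∀ i, (ρ i).comp (σ' i) = σ) :
    ∃ L : Subfield κ, (∀ a, σ a ∈ L) ∧ (∀ i x, ρ i x ∈ L) ∧
      (L = ⊤ → ringTrdeg σ ≤ Cardinal.sum fun i ↦ ringTrdeg (σ' i)) := by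
  let := σ.toAlgebra
  let (i : I) : Algebra K (E i) := (σ' i).toAlgebra
  have hf (i : I) : FaithfulSMul K (E i) :=
    (faithfulSMul_iff_algebraMap_injective _ _).mpr (algebraMap K (E i)).injective
  have hB (i : I) : ∃ s : Set (E i), IsTranscendenceBasis K ((↑) : s → E i) :=
    exists_isTranscendenceBasis K (E i)
  choose B hB using hB
  let s : Set κ := ⋃ i, ρ i '' B i
  let L : Subfield κ :=
    { (Subalgebra.algebraicClosure (Algebra.adjoin K s) κ).toSubring with
      inv_mem' := fun x hx ↦ IsAlgebraic.inv hx }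
  have hL {x : κ} : x ∈ L ↔ IsAlgebraic (Algebra.adjoin K s) x := Iff.rfl
  let ρ' (i : I) : E i →ₐ[K] κ := ⟨ρ i, fun a ↦ DFunLike.congr_fun (hρ i) a⟩
  refine ⟨L, fun a ↦ ?_, fun i x ↦ ?_, fun h ↦ ?_⟩
  · exact hL.mpr (isAlgebraic_algebraMap
      (⟨σ a, Subalgebra.algebraMap_mem _ a⟩ : Algebra.adjoin K s))
  · have halg : Algebra.IsAlgebraic (Algebra.adjoin K (B i)) (E i) := by
      have := (hB i).isAlgebraic
      rwa [Subtype.range_coe] at this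
    have hmap : ∀ z : Algebra.adjoin K (B i), ρ i z ∈ Algebra.adjoin K s := by
      rintro ⟨z, hz⟩
      have : ρ' i z ∈ (Algebra.adjoin K (B i)).map (ρ' i) := ⟨z, hz, rfl⟩
      rw [AlgHom.map_adjoin] at this
      exact Algebra.adjoin_mono (Set.subset_iUnion (fun i ↦ ρ i '' B i) i) this
    let φ : Algebra.adjoin K (B i) →+* Algebra.adjoin K s :=
      ((ρ i).comp (algebraMap (Algebra.adjoin K (B i)) (E i))).codRestrict _ hmap
    refine hL.mpr ((halg.isAlgebraic x).ringHom_of_comp_eq φ (ρ i) ?_ rfl)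
    intro a b hab
    exact Subtype.ext ((ρ i).injective (congrArg Subtype.val hab))
  · have halg : Algebra.IsAlgebraic (Algebra.adjoin K s) κ :=
      ⟨fun x ↦ hL.mp (h ▸ Subfield.mem_top x)⟩
    calc ringTrdeg σ ≤ Cardinal.mk s := Algebra.IsAlgebraic.trdeg_le_cardinalMk K s
      _ ≤ Cardinal.sum fun i ↦ Cardinal.mk (ρ i '' B i) := Cardinal.mk_iUnion_le_sum_mk
      _ ≤ Cardinal.sum fun i ↦ ringTrdeg (σ' i) := Cardinal.sum_le_sum _ _ fun i ↦
        Cardinal.mk_image_le.trans (hB i).cardinalMk_eq_trdeg.le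

theorem ptRank_le_sum {P : Scheme} (p : P ⟶ SpecK K) (w : P) {I : Type} (Y : I → Scheme)
    (g : ∀ i, Y i ⟶ SpecK K) (q : ∀ i, P ⟶ Y i) (hq : ∀ i, q i ≫ g i = p)
    (hP : ∀ {S T : Scheme} (j : T ⟶ S) (c : S ⟶ SpecK K) (t : T ⟶ P) (s : ∀ i, S ⟶ Y i),
      t ≫ p = j ≫ c → (∀ i, s i ≫ g i = c) → (∀ i, j ≫ s i = t ≫ q i) → ∃ h : S ⟶ P, j ≫ h = t) :
    ptRank p w ≤ Cardinal.sum fun i ↦ ptRank (g i) (q i w) := by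
  have hρ (i : I) : ((q i).residueFieldMap w).hom.comp (ptHom (g i) (q i w)) = ptHom p w := by
    rw [← ptHom_comp, hq]
  obtain ⟨L, hL1, hL2, hL3⟩ := exists_subfield_ringTrdeg_le (ptHom p w) _ _ _ hρ
  apply hL3
  let incl : CommRingCat.of L ⟶ P.residueField w := CommRingCat.ofHom L.subtype
  let c : CommRingCat.of K ⟶ CommRingCat.of L :=
    CommRingCat.ofHom ((ptHom p w).codRestrict L hL1)
  let r (i : I) : (Y i).residueField (q i w) ⟶ CommRingCat.of L :=
    CommRingCat.ofHom (((q i).residueFieldMap w).hom.codRestrict L (hL2 i))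
  have hr (i : I) : r i ≫ incl = (q i).residueFieldMap w := rfl
  obtain ⟨h, hh⟩ := hP (Spec.map incl) (Spec.map c) (P.fromSpecResidueField w)
    (fun i ↦ Spec.map (r i) ≫ (Y i).fromSpecResidueField (q i w))
    (by rw [← specMap_ptHom, ← Spec.map_comp]; rfl)
    (fun i ↦ by
      rw [Category.assoc, ← specMap_ptHom, ← Spec.map_comp]
      congr 1
      exact CommRingCat.hom_ext (RingHom.ext fun x ↦
        Subtype.ext (show _ = (ptHom p w) x from DFunLike.congr_fun (hρ i) x)))
    (fun i ↦ by
      rw [← Category.assoc, ← Spec.map_comp, hr,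
        Scheme.Hom.SpecMap_residueFieldMap_fromSpecResidueField])
  obtain ⟨⟨x, ψ⟩, rfl⟩ := (Scheme.SpecToEquivOfField L P).symm.surjective h
  have hx : x = w := by
    let o : Spec (P.residueField w) := IsLocalRing.closedPoint (P.residueField w)
    have ho : P.fromSpecResidueField x (Spec.map ψ (Spec.map incl o)) =
      P.fromSpecResidueField w o := congr($hh o)
    rwa [Scheme.fromSpecResidueField_apply, Scheme.fromSpecResidueField_apply] at ho
  subst hx
  have h1 : ψ ≫ incl = 𝟙 _ := by
    apply Spec.map_injective
    rw [← cancel_mono (P.fromSpecResidueField x), Spec.map_comp, Category.assoc]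
    simpa using hh
  rw [eq_top_iff]
  rintro y -
  have : incl (ψ y) = y := congr($h1 y)
  rw [← this]
  exact (ψ y).2

theorem isPullback_of_isLimit_binaryFan {S : Scheme} {A B : Over S} (c : BinaryFan A B)
    (hc : IsLimit c) : IsPullback c.fst.left c.snd.left A.hom B.hom :=
  IsPullback.of_isLimit (c := PullbackCone.mk c.fst.left c.snd.left
      ((Over.w c.fst).trans (Over.w c.snd).symm))
    (Limits.IsLimit.pullbackConeEquivBinaryFanInverse (f := A.hom) (g := B.hom)
      (c := c) hc)

theorem pow_hom_of_stable (P : MorphismProperty Scheme) [P.IsStableUnderBaseChange]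
    [P.IsStableUnderComposition] [P.ContainsIdentities] (hV : P V.hom) (E : Type) [Finite E] :
    P (pow K V E).hom := by
  have h1 : (P.overObj (X := SpecK K)).IsClosedUnderBinaryProducts :=
    ⟨by
      rintro X ⟨⟨diag, π, isLim⟩, hp⟩
      have h := isPullback_of_isLimit_binaryFan
        ((Cone.postcompose (diagramIsoPair diag).hom).obj ⟨X, π⟩)
        ((IsLimit.postcomposeHomEquiv (diagramIsoPair diag) _).symm isLim)
      have h2 := P.of_isPullback h.flip (hp _)
      have h3 := P.comp_mem _ _ h2 (hp ⟨.left⟩)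
      have h4 := Over.w (BinaryFan.fst ((Cone.postcompose (diagramIsoPair diag).hom).obj ⟨X, π⟩))
      change P X.hom
      change _ = X.hom at h4
      rw [← h4]
      exact h3⟩
  have : (P.overObj (X := SpecK K)).IsClosedUnderFiniteProducts :=
    ObjectProperty.IsClosedUnderFiniteProducts.mk'
  exact ObjectProperty.prop_product (P.overObj (X := SpecK K)) (f := fun _ : E ↦ V) fun _ ↦ hV

theorem pow_locallyOfFiniteType (hft : LocallyOfFiniteType V.hom) (E : Type) [Finite E] :
    LocallyOfFiniteType (pow K V E).hom :=
  have : MorphismProperty.ContainsIdentities @LocallyOfFiniteType := ⟨fun _ ↦ inferInstance⟩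
  pow_hom_of_stable V @LocallyOfFiniteType hft E

theorem pow_quasiCompact (hqc : QuasiCompact V.hom) (E : Type) [Finite E] :
    QuasiCompact (pow K V E).hom :=
  have : MorphismProperty.ContainsIdentities @QuasiCompact := ⟨fun _ ↦ inferInstance⟩
  pow_hom_of_stable V @QuasiCompact hqc E

theorem noetherianSpace_of_finiteType {Y : Scheme} (f : Y ⟶ SpecK K) [LocallyOfFiniteType f]
    [QuasiCompact f] : TopologicalSpace.NoetherianSpace Y := by
  have := LocallyOfFiniteType.isLocallyNoetherian f
  have : CompactSpace Y := QuasiCompact.compactSpace_of_compactSpace f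
  have : IsNoetherian Y := {}
  infer_instance

variable {V}

/-- The coordinate projections of the fibered power. -/
def powProj {E : Type} [Finite E] (e : E) : pow K V E ⟶ V := Pi.π (fun _ : E ↦ V) e

/-- The morphism to the fibered power with given coordinates. -/
def powLift {E : Type} [Finite E] {W : Over (SpecK K)} (a : E → (W ⟶ V)) : W ⟶ pow K V E :=
  Pi.lift a

@[simp]
theorem powLift_proj {E : Type} [Finite E] {W : Over (SpecK K)} (a : E → (W ⟶ V)) (e : E) :
    powLift a ≫ powProj e = a e :=
  Pi.lift_π a e

theorem pow_hom_ext {E : Type} [Finite E] {W : Over (SpecK K)} {a b : W ⟶ pow K V E}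
    (h : ∀ e, a ≫ powProj e = b ≫ powProj e) : a = b :=
  Pi.hom_ext _ _ h

theorem ptPow_comp_powProj {E : Type} [Finite E] (u : E → Pt K V) (e : E) :
    ptPow K V E u ≫ powProj e = u e :=
  powLift_proj u e

theorem ptPow_comp_powLift {E Ω : Type} [Finite E] [Finite Ω] (u : E → Pt K V)
    (a : Ω → (pow K V E ⟶ V)) :
    ptPow K V E u ≫ powLift a = ptPow K V Ω fun ω ↦ ptPow K V E u ≫ a ω :=
  pow_hom_ext fun e ↦ by rw [Category.assoc, powLift_proj, ptPow_comp_powProj]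

theorem ev_comp {W W' : Over (SpecK K)} (a : Pt K W) (f : W ⟶ W') :
    ev K (a ≫ f) = f.left (ev K a) := rfl

theorem ptRank_pow_le_sum {E I : Type} [Finite E] (Y : I → Over (SpecK K))
    (q : ∀ i, pow K V E ⟶ Y i) (hq : ∀ e, ∃ (i : I) (r : Y i ⟶ V), q i ≫ r = powProj e)
    (w : (pow K V E).left) :
    ptRank (pow K V E).hom w ≤ Cardinal.sum fun i ↦ ptRank (Y i).hom ((q i).left w) := by
  refine ptRank_le_sum (pow K V E).hom w (fun i ↦ (Y i).left) (fun i ↦ (Y i).hom)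
    (fun i ↦ (q i).left) (fun i ↦ Over.w (q i)) fun {S T} j c t s ht hs hj ↦ ?_
  choose i r hr using hq
  let h : Over.mk c ⟶ pow K V E :=
    powLift fun e ↦ Over.homMk (U := Over.mk c) (s (i e)) (hs (i e)) ≫ r e
  refine ⟨h.left, ?_⟩
  suffices (Over.homMk j rfl : Over.mk (j ≫ c) ⟶ Over.mk c) ≫ h =
      Over.homMk (U := Over.mk (j ≫ c)) t ht from congr(($this).left)
  refine pow_hom_ext fun e ↦ ?_
  rw [Category.assoc, powLift_proj, ← hr e, ← Category.assoc, ← Category.assoc]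
  congr 1
  ext1
  exact hj (i e)

/-- The dimension of the closure of a point, as a natural number. -/
def ptRankNat (Y : Over (SpecK K)) (y : Y.left) : ℕ := Cardinal.toNat (ptRank Y.hom y)

theorem ptRankNat_pow_le_sum {E I : Type} [Finite E] [Fintype I] (Y : I → Over (SpecK K))
    (hY : ∀ i, LocallyOfFiniteType (Y i).hom)
    (q : ∀ i, pow K V E ⟶ Y i) (hq : ∀ e, ∃ (i : I) (r : Y i ⟶ V), q i ≫ r = powProj e)
    (w : (pow K V E).left) :
    ptRankNat _ w ≤ ∑ i, ptRankNat (Y i) ((q i).left w) := by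
  have h := ptRank_pow_le_sum Y q hq w
  have h1 : (Cardinal.sum fun i ↦ ptRank (Y i).hom ((q i).left w)) =
      ((∑ i, ptRankNat (Y i) ((q i).left w) : ℕ) : Cardinal) := by
    have (i : I) : ptRank (Y i).hom ((q i).left w) =
        Cardinal.mk (Fin (ptRankNat (Y i) ((q i).left w))) := by
      rw [Cardinal.mk_fin, ptRankNat, Cardinal.cast_toNat_of_lt_aleph0]
      exact ptRank_lt_aleph0 _ _
    simp_rw [this]
    rw [← Cardinal.mk_sigma, Cardinal.mk_fintype, Fintype.card_sigma]
    simp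
  rw [h1] at h
  exact Cardinal.toNat_le_iff_le_of_lt_aleph0 (h.trans_lt (Cardinal.natCast_lt_aleph0))
    Cardinal.natCast_lt_aleph0 |>.mpr h |>.trans_eq (Cardinal.toNat_natCast _)

theorem ptRankNat_lt_of_specializes (Y : Over (SpecK K)) [LocallyOfFiniteType Y.hom]
    {y y' : Y.left} (h : y ⤳ y') (hne : y ≠ y') : ptRankNat Y y' < ptRankNat Y y :=
  Cardinal.toNat_lt_toNat (ptRank_lt_of_specializes Y.hom h hne) (ptRank_lt_aleph0 _ _)

theorem ptRankNat_le_of_specializes (Y : Over (SpecK K)) [LocallyOfFiniteType Y.hom]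
    {y y' : Y.left} (h : y ⤳ y') : ptRankNat Y y' ≤ ptRankNat Y y :=
  Cardinal.toNat_le_toNat (ptRank_le_of_specializes Y.hom h) (ptRank_lt_aleph0 _ _)

theorem ptRankNat_map_le {Y Y' : Over (SpecK K)} [LocallyOfFiniteType Y.hom] (φ : Y ⟶ Y')
    (y : Y.left) : ptRankNat Y' (φ.left y) ≤ ptRankNat Y y := by
  refine Cardinal.toNat_le_toNat ?_ (ptRank_lt_aleph0 _ _)
  rw [← Over.w φ]
  exact ptRank_map_le φ.left Y'.hom y

/-- The generic point of an irreducible subset of the image of `W` is the image of a point in the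
closure of `W`. -/
theorem exists_isGenericPoint_image {X Y : Type*} [TopologicalSpace X] [TopologicalSpace Y]
    [TopologicalSpace.NoetherianSpace X] [QuasiSober X] {f : X → Y} (hf : Continuous f)
    {W : Set X} {Z : Set Y} (hZ : IsIrreducible Z) (hZW : Z ⊆ f '' W) :
    ∃ w ∈ closure W, IsGenericPoint (f w) (closure Z) := by
  obtain ⟨S, hS, hSW⟩ := TopologicalSpace.NoetherianSpace.exists_finite_set_isClosed_irreducible
    (isClosed_closure (s := W ∩ f ⁻¹' Z))
  obtain ⟨hcl, hirr, hU⟩ := hSW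
  have hcov : Z ⊆ ⋃₀ ((fun C ↦ closure (f '' C)) '' S) := by
    intro z hz
    obtain ⟨w, hw, rfl⟩ := hZW hz
    have h1 : w ∈ closure (W ∩ f ⁻¹' Z) := subset_closure ⟨hw, hz⟩
    rw [hU] at h1
    obtain ⟨C, hC, hwC⟩ := h1
    exact ⟨_, ⟨C, hC, rfl⟩, subset_closure ⟨w, hwC, rfl⟩⟩
  obtain ⟨_, hD, hZD⟩ := (isIrreducible_iff_sUnion_isClosed.mp hZ)
    (hS.image fun C ↦ closure (f '' C)).toFinset (by simp) (by simpa using hcov)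
  simp only [Set.Finite.mem_toFinset, Set.mem_image] at hD
  obtain ⟨C, hC, rfl⟩ := hD
  obtain ⟨w, hw⟩ := QuasiSober.sober (hirr C hC) (hcl C hC)
  have hwS : w ∈ closure (W ∩ f ⁻¹' Z) := by
    rw [hU]
    exact ⟨C, hC, hw.mem⟩
  refine ⟨w, closure_mono Set.inter_subset_left hwS, ?_⟩
  refine subset_antisymm ?_ ?_
  · refine closure_minimal (Set.singleton_subset_iff.mpr ?_) isClosed_closure
    refine closure_mono ?_ (image_closure_subset_closure_image hf ⟨w, hwS, rfl⟩)
    rintro _ ⟨x, hx, rfl⟩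
    exact hx.2
  · refine closure_minimal (hZD.trans ?_) isClosed_closure
    refine closure_minimal ?_ isClosed_closure
    rintro _ ⟨x, hx, rfl⟩
    rw [← hw.def] at hx
    simpa using image_closure_subset_closure_image hf ⟨x, hx, rfl⟩

theorem topologicalKrullDim_le_of_rank {T Y : Type*} [TopologicalSpace T] [TopologicalSpace Y]
    [QuasiSober Y] {e : T → Y} (he : IsInducing e) (r : Y → ℕ)
    (hr : ∀ y y' : Y, y ⤳ y' → ¬ y' ⤳ y → r y' < r y) (N : ℕ)
    (hN : ∀ Z ⊆ Set.range e, IsIrreducible Z → ∀ z, IsGenericPoint z (closure Z) → r z ≤ N) :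
    topologicalKrullDim T ≤ N := by
  have hirr (C : TopologicalSpace.IrreducibleCloseds T) : IsIrreducible (e '' (C : Set T)) :=
    C.isIrreducible.image e he.continuous.continuousOn
  choose g hg using fun C ↦ QuasiSober.sober (hirr C).closure isClosed_closure
  have hmono : StrictMono fun C ↦ r (g C) := by
    intro C D hCD
    have hsub : (C : Set T) ⊆ D := hCD.le
    refine hr _ _ ((hg D).specializes (closure_mono (Set.image_mono hsub) (hg C).mem)) fun h ↦ ?_
    refine hCD.not_ge fun x (hx : x ∈ (D : Set T)) ↦ ?_
    have h1 : e x ∈ closure (e '' (C : Set T)) := by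
      rw [← (hg C).def]
      exact specializes_iff_mem_closure.mp
        (h.trans ((hg D).specializes (subset_closure ⟨x, hx, rfl⟩)))
    have h2 := he.closure_eq_preimage_closure_image (C : Set T)
    rw [C.isClosed.closure_eq] at h2
    change x ∈ (C : Set T)
    rw [h2]
    exact h1
  refine iSup_le fun p ↦ ?_
  have h1 := LTSeries.head_add_length_le_nat (p.map _ hmono)
  have h2 : r (g p.last) ≤ N := hN _ (Set.image_subset_range _ _) (hirr _) _ (hg _)
  have h3 : p.length ≤ N := by
    change _ + p.length ≤ r (g p.last) at h1
    omega
  exact_mod_cast h3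

/-- The map from families of points to the underlying space of the fibered power. -/
def cfgEv {E : Type} [Finite E] (u : E → Pt K V) : (pow K V E).left := ev K (ptPow K V E u)

theorem cfgEv_comp {E Ω : Type} [Finite E] [Finite Ω] (u : E → Pt K V)
    (a : Ω → (pow K V E ⟶ V)) :
    (powLift a).left (cfgEv u) = cfgEv fun ω ↦ ptPow K V E u ≫ a ω := by
  rw [cfgEv, ← ev_comp, ptPow_comp_powLift, cfgEv]

theorem exists_ev_mem [IsAlgClosed K] (Y : Over (SpecK K)) [LocallyOfFiniteType Y.hom]
    {O : Set Y.left} (hO : IsOpen O) (hne : O.Nonempty) : ∃ a : Pt K Y, ev K a ∈ O := by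
  have : JacobsonSpace Y.left := LocallyOfFiniteType.jacobsonSpace Y.hom
  obtain ⟨x, hxO, hx⟩ := nonempty_inter_closedPoints hne hO.isLocallyClosed
  refine ⟨Over.homMk (pointOfClosedPoint Y.hom x hx) (pointOfClosedPoint_comp Y.hom x hx), ?_⟩
  have : ev K (Over.homMk (pointOfClosedPoint Y.hom x hx)
      (pointOfClosedPoint_comp Y.hom x hx) : Pt K Y) = x :=
    pointOfClosedPoint_apply Y.hom x hx (specPt K)
  rwa [this]

theorem exists_cfgEv_update {E : Type} [Finite E] [DecidableEq E] (u : E → Pt K V) (i : E) :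
    ∃ σ : V ⟶ pow K V E, ∀ a, cfgEv (Function.update u i a) = σ.left (ev K a) := by
  refine ⟨powLift fun j ↦ if j = i then 𝟙 V else Over.mkIdTerminal.from V ≫ u j, fun a ↦ ?_⟩
  rw [← ev_comp, cfgEv]
  congr 1
  refine pow_hom_ext fun j ↦ ?_
  rw [ptPow_comp_powProj, Category.assoc, powLift_proj]
  split_ifs with h
  · subst h
    simp
  · rw [Function.update_of_ne h, ← Category.assoc]
    have : a ≫ Over.mkIdTerminal.from V = 𝟙 (Over.mk (𝟙 (SpecK K))) :=
      Over.mkIdTerminal.hom_ext _ _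
    rw [this, Category.id_comp]

theorem exists_cfgEv_mem_inter [IsAlgClosed K] [LocallyOfFiniteType V.hom]
    [IrreducibleSpace V.left] {E : Type} [Finite E] {U₁ U₂ : Set (pow K V E).left}
    (h₁ : IsOpen U₁) (h₂ : IsOpen U₂) (s : Finset E) (u v : E → Pt K V)
    (huv : ∀ i ∉ s, u i = v i) (hu : cfgEv u ∈ U₁) (hv : cfgEv v ∈ U₂) :
    ∃ w : E → Pt K V, cfgEv w ∈ U₁ ∩ U₂ := by
  classical
  induction s using Finset.induction_on generalizing u v with
  | empty =>
    obtain rfl : u = v := funext fun i ↦ huv i (by simp)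
    exact ⟨u, hu, hv⟩
  | insert i s his ih =>
    obtain ⟨σ, hσ⟩ := exists_cfgEv_update u i
    obtain ⟨σ', hσ'⟩ := exists_cfgEv_update v i
    have hO₁ := h₁.preimage σ.left.continuous
    have hO₂ := h₂.preimage σ'.left.continuous
    have hn₁ : (σ.left ⁻¹' U₁).Nonempty := ⟨ev K (u i), by
      rw [Set.mem_preimage, ← hσ, Function.update_eq_self]
      exact hu⟩
    have hn₂ : (σ'.left ⁻¹' U₂).Nonempty := ⟨ev K (v i), by
      rw [Set.mem_preimage, ← hσ', Function.update_eq_self]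
      exact hv⟩
    obtain ⟨a, ha₁, ha₂⟩ := exists_ev_mem V (hO₁.inter hO₂)
      (nonempty_preirreducible_inter hO₁ hO₂ hn₁ hn₂)
    rw [Set.mem_preimage, ← hσ] at ha₁
    rw [Set.mem_preimage, ← hσ'] at ha₂
    refine ih _ _ (fun j hj ↦ ?_) ha₁ ha₂
    by_cases hji : j = i
    · subst hji
      simp
    · simp [hji, huv j (by simp [hji, hj])]

theorem isPreirreducible_range_cfgEv [IsAlgClosed K] [LocallyOfFiniteType V.hom]
    [IrreducibleSpace V.left] (E : Type) [Finite E] :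
    IsPreirreducible (Set.range (cfgEv : (E → Pt K V) → (pow K V E).left)) := by
  have := Fintype.ofFinite E
  rintro U₁ U₂ h₁ h₂ ⟨_, ⟨u, rfl⟩, hu⟩ ⟨_, ⟨v, rfl⟩, hv⟩
  obtain ⟨w, hw⟩ := exists_cfgEv_mem_inter h₁ h₂ Finset.univ u v (by simp) hu hv
  exact ⟨_, ⟨w, rfl⟩, hw⟩

/-- The rank of the generic point of an irreducible variety. -/
def genRank (V : Over (SpecK K)) [IrreducibleSpace V.left] : ℕ :=
  ptRankNat V (genericPoint V.left)

theorem ptRankNat_le_genRank [LocallyOfFiniteType V.hom] [IrreducibleSpace V.left]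
    (x : V.left) : ptRankNat V x ≤ genRank V :=
  ptRankNat_le_of_specializes V (genericPoint_specializes x)

theorem genRank_le_vdim [LocallyOfFiniteType V.hom] [IrreducibleSpace V.left] :
    ((genRank V : ℕ) : WithBot ℕ∞) ≤ vdim K V :=
  ptRank_le_topologicalKrullDim V.hom _

theorem ptRankNat_pow_le [LocallyOfFiniteType V.hom] [IrreducibleSpace V.left] {E : Type}
    [Fintype E] (w : (pow K V E).left) : ptRankNat _ w ≤ Fintype.card E * genRank V := by
  refine (ptRankNat_pow_le_sum (fun _ : E ↦ V) (fun _ ↦ inferInstance) powProj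
    (fun e ↦ ⟨e, 𝟙 V, Category.comp_id _⟩) w).trans ?_
  refine (Finset.sum_le_sum fun i _ ↦ ptRankNat_le_genRank _).trans ?_
  simp

theorem ptRankNat_lt_of_mem_closure [IsAlgClosed K] [LocallyOfFiniteType V.hom]
    [IrreducibleSpace V.left] {Ω : Type} [Fintype Ω] {H : Set (Ω → Pt K V)}
    (hH : cfgClosed K V Ω H) (hne : H ≠ Set.univ) {x : (pow K V Ω).left}
    (hx : x ∈ closure (cfgEv '' H)) : ptRankNat _ x < Fintype.card Ω * genRank V := by
  have := pow_locallyOfFiniteType V inferInstance Ω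
  obtain ⟨C, hC, rfl⟩ : ∃ C : Set (pow K V Ω).left, IsClosed C ∧ cfgEv ⁻¹' C = H :=
    (@isClosed_induced_iff _ _ _ H cfgEv).mp hH
  have hxC : x ∈ C := closure_minimal (Set.image_preimage_subset _ _) hC hx
  have hn : (Set.range (cfgEv : (Ω → Pt K V) → (pow K V Ω).left)).Nonempty :=
    (closure_nonempty_iff.mp ⟨x, hx⟩).mono (Set.image_subset_range _ _)
  have hirr : IsIrreducible (Set.range (cfgEv : (Ω → Pt K V) → (pow K V Ω).left)) :=
    ⟨hn, isPreirreducible_range_cfgEv Ω⟩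
  obtain ⟨y, hy⟩ := QuasiSober.sober hirr.closure isClosed_closure
  refine (ptRankNat_lt_of_specializes _
    (hy.specializes (closure_mono (Set.image_subset_range _ _) hx)) ?_).trans_le
    (ptRankNat_pow_le y)
  rintro rfl
  refine hne (Set.eq_univ_of_forall fun u ↦ ?_)
  exact hC.closure_subset_iff.mpr (Set.singleton_subset_iff.mpr hxC)
    (hy.def.symm ▸ subset_closure ⟨u, rfl⟩)

theorem ptRankNat_add_card_le [IsAlgClosed K] [LocallyOfFiniteType V.hom]
    [IrreducibleSpace V.left] {Ω E J : Type} [Fintype Ω] [Fintype E] [Fintype J]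
    {H : Set (Ω → Pt K V)} (hH : cfgClosed K V Ω H) (hne : H ≠ Set.univ) (j : J → Ω → E)
    (hj : Function.Injective fun p : J × Ω ↦ j p.1 p.2) {w : (pow K V E).left}
    (hw : w ∈ closure (cfgEv '' {u : E → Pt K V | ∀ i, (fun ω ↦ u (j i ω)) ∈ H})) :
    ptRankNat _ w + Fintype.card J ≤ Fintype.card E * genRank V := by
  classical
  have := pow_locallyOfFiniteType V inferInstance Ω
  let R := {e : E // e ∉ Set.range fun p : J × Ω ↦ j p.1 p.2}
  let Y : J ⊕ R → Over (SpecK K) := Sum.elim (fun _ ↦ pow K V Ω) fun _ ↦ V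
  let q : ∀ i, pow K V E ⟶ Y i
    | .inl i => powLift fun ω ↦ powProj (j i ω)
    | .inr e => powProj e.1
  have hq : ∀ e, ∃ (i : J ⊕ R) (r : Y i ⟶ V), q i ≫ r = powProj e := by
    intro e
    by_cases he : e ∈ Set.range fun p : J × Ω ↦ j p.1 p.2
    · obtain ⟨⟨i, ω⟩, rfl⟩ := he
      exact ⟨.inl i, powProj ω, powLift_proj _ _⟩
    · exact ⟨.inr ⟨e, he⟩, 𝟙 V, Category.comp_id _⟩
  have hY : ∀ i, LocallyOfFiniteType (Y i).hom := by
    rintro (i | e)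
    · exact this
    · exact inferInstanceAs (LocallyOfFiniteType V.hom)
  have h := ptRankNat_pow_le_sum Y hY q hq w
  rw [Fintype.sum_sum_type] at h
  have h1 : ∑ i : J, (ptRankNat (Y (.inl i)) ((q (.inl i)).left w) + 1) ≤
      Fintype.card J * (Fintype.card Ω * genRank V) := by
    refine (Finset.sum_le_card_nsmul _ _ (Fintype.card Ω * genRank V) fun i _ ↦ ?_).trans_eq
      (by simp)
    refine ptRankNat_lt_of_mem_closure hH hne ?_
    have hc := image_closure_subset_closure_image (q (.inl i)).left.continuous ⟨w, hw, rfl⟩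
    refine closure_mono ?_ hc
    rintro _ ⟨_, ⟨u, hu, rfl⟩, rfl⟩
    refine ⟨_, hu i, ?_⟩
    exact ((cfgEv_comp u _).trans (by simp_rw [ptPow_comp_powProj])).symm
  have h2 : ∑ e : R, ptRankNat (Y (.inr e)) ((q (.inr e)).left w) ≤
      Fintype.card R * genRank V :=
    (Finset.sum_le_card_nsmul _ _ (genRank V) fun e _ ↦ ptRankNat_le_genRank _).trans_eq
      (by simp)
  rw [Finset.sum_add_distrib] at h1
  have h3 : Fintype.card R = Fintype.card E - Fintype.card (J × Ω) := by
    rw [Fintype.card_subtype_compl, ← Set.card_range_of_injective hj]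
  have h4 : Fintype.card (J × Ω) ≤ Fintype.card E := Fintype.card_le_of_injective _ hj
  have h5 : Fintype.card R + Fintype.card J * Fintype.card Ω = Fintype.card E := by
    rw [h3, ← Fintype.card_prod, Nat.sub_add_cancel h4]
  rw [← h5, add_mul, mul_assoc]
  simp only [Finset.sum_const, Finset.card_univ, smul_eq_mul, mul_one] at h1
  omega

/-- If `τ((A^Ω)_p) = τ(H_p)` for all `p`, a configuration can be modified on a translate of `Ω`,
without changing its image, so that its restriction to this translate lies in `H`. -/
theorem exists_replacement {τ : (G → Pt K V) → (G → Pt K V)}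
    (hτ : ∀ x g h, τ (fun k ↦ x (g * k)) h = τ x (g * h))
    {Ω : Finset G} {H : Set (↥Ω → Pt K V)}
    (hH : ∀ p : {g : G // g ∉ Ω} → Pt K V, τ '' cyl K V Ω Set.univ p = τ '' cyl K V Ω H p)
    (c : G → Pt K V) (g : G) :
    ∃ c', τ c' = τ c ∧ (fun ω : ↥Ω ↦ c' (g * ω)) ∈ H ∧ ∀ h, g⁻¹ * h ∉ Ω → c' h = c h := by
  have h1 : τ (fun k ↦ c (g * k)) ∈ τ '' cyl K V Ω H fun k ↦ c (g * k.1) := by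
    rw [← hH]
    exact ⟨_, ⟨trivial, fun _ _ ↦ rfl⟩, rfl⟩
  obtain ⟨b, ⟨hbH, hb⟩, hbτ⟩ := h1
  refine ⟨fun k ↦ b (g⁻¹ * k), funext fun k ↦ ?_, by simpa using hbH, fun h hh ↦ ?_⟩
  · rw [hτ, hbτ, hτ, mul_inv_cancel_left]
  · exact (hb _ hh).trans (congrArg c (mul_inv_cancel_left g h))

theorem exists_replacement_finset {τ : (G → Pt K V) → (G → Pt K V)}
    (hτ : ∀ x g h, τ (fun k ↦ x (g * k)) h = τ x (g * h))
    {Ω : Finset G} {H : Set (↥Ω → Pt K V)}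
    (hH : ∀ p : {g : G // g ∉ Ω} → Pt K V, τ '' cyl K V Ω Set.univ p = τ '' cyl K V Ω H p)
    (c : G → Pt K V) (J : Finset G)
    (hJ : ∀ g ∈ J, ∀ h ∈ J, ∀ a ∈ Ω, ∀ b ∈ Ω, g * a = h * b → g = h) :
    ∃ c', τ c' = τ c ∧ ∀ g ∈ J, (fun ω : ↥Ω ↦ c' (g * ω)) ∈ H := by
  classical
  induction J using Finset.induction_on with
  | empty => exact ⟨c, rfl, by simp⟩
  | insert g J hg ih =>
    obtain ⟨b, hbτ, hb⟩ := ih fun x hx y hy ↦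
      hJ x (Finset.mem_insert_of_mem hx) y (Finset.mem_insert_of_mem hy)
    obtain ⟨c', hc'τ, hc'H, hc'⟩ := exists_replacement hτ hH b g
    refine ⟨c', hc'τ.trans hbτ, fun x hx ↦ ?_⟩
    rcases Finset.mem_insert.mp hx with rfl | hxJ
    · exact hc'H
    · convert hb x hxJ using 2 with ω
      refine hc' _ fun hω ↦ hg ?_
      rw [hJ g (Finset.mem_insert_self _ _) x hx _ hω ω ω.2 (by simp)]
      exact hxJ

theorem exists_disjoint_translates (F Ω : Finset G) (hΩ : Ω.Nonempty) :
    ∃ J ⊆ F, (∀ g ∈ J, ∀ h ∈ J, ∀ a ∈ Ω, ∀ b ∈ Ω, g * a = h * b → g = h) ∧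
      F.card ≤ J.card * Ω.card ^ 2 := by
  classical
  let S := F.powerset.filter fun J ↦ ∀ g ∈ J, ∀ h ∈ J, ∀ a ∈ Ω, ∀ b ∈ Ω, g * a = h * b → g = h
  obtain ⟨J, hJS, hmax⟩ := S.exists_max_image Finset.card ⟨∅, by simp [S]⟩
  simp only [S, Finset.mem_filter, Finset.mem_powerset] at hJS hmax
  refine ⟨J, hJS.1, hJS.2, ?_⟩
  have hsub : F ⊆ (J ×ˢ Ω ×ˢ Ω).image fun p ↦ p.1 * p.2.1 * p.2.2⁻¹ := by
    intro g hg
    suffices ∃ h ∈ J, ∃ a ∈ Ω, ∃ b ∈ Ω, g * a = h * b by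
      obtain ⟨h, hh, a, ha, b, hb, hab⟩ := this
      refine Finset.mem_image.mpr ⟨(h, b, a), by simp [hh, ha, hb], ?_⟩
      simp [← hab]
    by_contra! hcon
    obtain ⟨o, ho⟩ := hΩ
    have hgJ : g ∉ J := fun hgJ ↦ hcon g hgJ o ho o ho rfl
    have h1 := hmax (insert g J) ⟨Finset.insert_subset hg hJS.1, fun x hx y hy a ha b hb hab ↦ by
      rcases Finset.mem_insert.mp hx with rfl | hxJ <;>
        rcases Finset.mem_insert.mp hy with rfl | hyJ
      · rfl
      · exact absurd hab (hcon y hyJ a ha b hb)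
      · exact absurd hab.symm (hcon x hxJ b hb a ha)
      · exact hJS.2 x hxJ y hyJ a ha b hb hab⟩
    rw [Finset.card_insert_of_notMem hgJ] at h1
    omega
  refine (Finset.card_le_card hsub).trans (Finset.card_image_le.trans_eq ?_)
  rw [Finset.card_product, Finset.card_product, sq]

theorem exists_finset_mul_card_le (F T : Finset G) :
    ∃ E : Finset G, (∀ g ∈ F, ∀ t ∈ T, g * t ∈ E) ∧
      E.card ≤ F.card + ∑ t ∈ T, ((F : Set G) \ ((· * t) '' (F : Set G))).ncard := by
  classical
  refine ⟨F ∪ T.biUnion fun t ↦ F.image (· * t) \ F, fun g hg t ht ↦ ?_, ?_⟩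
  · by_cases h : g * t ∈ F
    · exact Finset.mem_union_left _ h
    · exact Finset.mem_union_right _ (Finset.mem_biUnion.mpr
        ⟨t, ht, Finset.mem_sdiff.mpr ⟨Finset.mem_image_of_mem _ hg, h⟩⟩)
  · refine (Finset.card_union_le _ _).trans (Nat.add_le_add_left
      (Finset.card_biUnion_le.trans_eq (Finset.sum_congr rfl fun t _ ↦ ?_)) _)
    rw [← Finset.coe_image, ← Finset.coe_sdiff, Set.ncard_coe_finset]
    exact Finset.card_sdiff_comm (Finset.card_image_of_injective _ (mul_left_injective t))

theorem cfgDim_restr_range_le [IsAlgClosed K] [LocallyOfFiniteType V.hom]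
    [QuasiCompact V.hom] [IrreducibleSpace V.left] {τ : (G → Pt K V) → (G → Pt K V)}
    {M : Finset G} {f : pow K V ↥M ⟶ V}
    (hτ : ∀ x g, τ x g = ptPow K V ↥M (fun m ↦ x (g * (m : G))) ≫ f)
    {Ω : Finset G} {H : Set (↥Ω → Pt K V)} (hHc : cfgClosed K V ↥Ω H) (hne : H ≠ Set.univ)
    (hH : ∀ p : {g : G // g ∉ Ω} → Pt K V, τ '' cyl K V Ω Set.univ p = τ '' cyl K V Ω H p)
    {F E J : Finset G} (hJ : ∀ g ∈ J, ∀ h ∈ J, ∀ a ∈ Ω, ∀ b ∈ Ω, g * a = h * b → g = h)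
    (hFE : ∀ g ∈ F, ∀ m ∈ M, g * m ∈ E) (hJE : ∀ g ∈ J, ∀ a ∈ Ω, g * a ∈ E) :
    J.card ≤ E.card * genRank V ∧
      cfgDim K V ↥F (restr K V (Set.range τ) F) ≤ ((E.card * genRank V - J.card : ℕ)) := by
  have := pow_locallyOfFiniteType V inferInstance E
  have := pow_locallyOfFiniteType V inferInstance F
  have := pow_quasiCompact V inferInstance E
  have := noetherianSpace_of_finiteType (pow K V ↥E).hom
  have hshift : ∀ x g h, τ (fun k ↦ x (g * k)) h = τ x (g * h) := fun x g h ↦ by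
    simp_rw [hτ, mul_assoc]
  have hrank {w : (pow K V ↥E).left} (hw : w ∈ closure (cfgEv ''
      {u : ↥E → Pt K V | ∀ i : ↥J, (fun ω : ↥Ω ↦ u ⟨i * ω, hJE i i.2 ω ω.2⟩) ∈ H})) :
      ptRankNat _ w + J.card ≤ E.card * genRank V := by
    have h1 := ptRankNat_add_card_le hHc hne
      (fun (g : ↥J) (ω : ↥Ω) ↦ (⟨g * ω, hJE g g.2 ω ω.2⟩ : ↥E)) ?_ hw
    · rwa [Fintype.card_coe, Fintype.card_coe] at h1
    · rintro ⟨g, a⟩ ⟨h, b⟩ hab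
      have hab : (g : G) * a = h * b := congrArg Subtype.val hab
      obtain rfl : g = h := Subtype.ext (hJ g g.2 h h.2 a a.2 b b.2 hab)
      rw [mul_right_inj] at hab
      rw [Subtype.ext hab]
  have hrepl := fun c ↦ exists_replacement_finset hshift hH c J hJ
  refine ⟨?_, ?_⟩
  · obtain ⟨a, -⟩ := exists_ev_mem V isOpen_univ Set.univ_nonempty
    obtain ⟨c, -, hc⟩ := hrepl fun _ ↦ a
    exact (Nat.le_add_left _ _).trans
      (hrank (subset_closure ⟨fun e ↦ c e, fun i ↦ hc i i.2, rfl⟩))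
  let φ : pow K V ↥E ⟶ pow K V ↥F := powLift fun g : ↥F ↦
    powLift (fun m : ↥M ↦ powProj (⟨g * m, hFE g g.2 m m.2⟩ : ↥E)) ≫ f
  have hφ (u : ↥E → Pt K V) : φ.left (cfgEv u) = cfgEv fun g : ↥F ↦
      ptPow K V ↥M (fun m : ↥M ↦ u ⟨g * m, hFE g g.2 m m.2⟩) ≫ f := by
    refine (cfgEv_comp u _).trans ?_
    congr 1
    funext g
    rw [← Category.assoc, ptPow_comp_powLift]
    simp_rw [ptPow_comp_powProj]
  let : TopologicalSpace (↥F → Pt K V) := cfgTop K V ↥F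
  have he : IsInducing (cfgEv : (↥F → Pt K V) → (pow K V ↥F).left) := ⟨rfl⟩
  refine topologicalKrullDim_le_of_rank (he.comp IsInducing.subtypeVal) (ptRankNat _)
    (fun y y' h h' ↦ ptRankNat_lt_of_specializes _ h fun hyy ↦ h' (hyy ▸ h)) _
    fun Z hZ hirr z hz ↦ ?_
  have hZW : Z ⊆ φ.left '' (cfgEv ''
      {u : ↥E → Pt K V | ∀ i : ↥J, (fun ω : ↥Ω ↦ u ⟨i * ω, hJE i i.2 ω ω.2⟩) ∈ H}) := by
    intro x hx
    obtain ⟨⟨_, ⟨_, ⟨c, rfl⟩, rfl⟩⟩, rfl⟩ := hZ hx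
    obtain ⟨b, hb, hbH⟩ := hrepl c
    refine ⟨_, ⟨fun e ↦ b e, fun i ↦ hbH i i.2, rfl⟩, (hφ _).trans ?_⟩
    change _ = cfgEv fun g : ↥F ↦ τ c g
    simp_rw [← hb, hτ]
  obtain ⟨w, hw, hwz⟩ := exists_isGenericPoint_image φ.left.continuous hirr hZW
  rw [hz.eq hwz]
  exact (ptRankNat_map_le φ w).trans (Nat.le_sub_of_add_le (hrank hw))

theorem coe_ennreal_natCast (n : ℕ) : (((n : ℝ≥0∞)) : EReal) = n := by
  rw [← ENNReal.coe_natCast, EReal.coe_nnreal_eq_coe_real, NNReal.coe_natCast, EReal.coe_natCast]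

theorem dimE_le_coe {x : WithBot ℕ∞} {n : ℕ} (h : x ≤ n) : dimE x ≤ ((n : ℝ) : EReal) := by
  induction x using WithBot.recBotCoe with
  | bot => exact bot_le
  | coe x =>
    have h : x ≤ n := WithBot.coe_le_coe.mp h
    lift x to ℕ using ne_top_of_le_ne_top (ENat.natCast_ne_top n) h
    have h : x ≤ n := by exact_mod_cast h
    change ((((x : ℕ∞) : ℝ≥0∞)) : EReal) ≤ _
    rw [ENat.toENNReal_coe, coe_ennreal_natCast, EReal.coe_natCast]
    exact_mod_cast h

theorem coe_le_dimE {x : WithBot ℕ∞} {n : ℕ} (h : n ≤ x) : ((n : ℝ) : EReal) ≤ dimE x := by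
  induction x using WithBot.recBotCoe with
  | bot => exact absurd h (by simp)
  | coe x =>
    have h : n ≤ x := WithBot.coe_le_coe.mp h
    have h : ((n : ℕ∞) : ℝ≥0∞) ≤ x := by exact_mod_cast h
    change _ ≤ ((x : ℝ≥0∞) : EReal)
    rw [ENat.toENNReal_coe] at h
    rw [EReal.coe_natCast, ← coe_ennreal_natCast]
    exact (EReal.coe_ennreal_le_coe_ennreal_iff.mpr h)

theorem FolnerNet.mdim_lt_genRank [IsAlgClosed K] [LocallyOfFiniteType V.hom]
    [QuasiCompact V.hom] [IrreducibleSpace V.left] (𝓕 : FolnerNet G)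
    {τ : (G → Pt K V) → (G → Pt K V)} {M : Finset G} {f : pow K V ↥M ⟶ V}
    (hτ : ∀ x g, τ x g = ptPow K V ↥M (fun m ↦ x (g * (m : G))) ≫ f)
    {Ω : Finset G} (hΩ : Ω.Nonempty) {H : Set (↥Ω → Pt K V)} (hHc : cfgClosed K V ↥Ω H)
    (hne : H ≠ Set.univ)
    (hH : ∀ p : {g : G // g ∉ Ω} → Pt K V, τ '' cyl K V Ω Set.univ p = τ '' cyl K V Ω H p) :
    mdim K V 𝓕 (Set.range τ) < ((genRank V : ℝ) : EReal) := by
  classical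
  set d := genRank V with hd
  let a : G → 𝓕.ι → ℝ := fun g i ↦
    (((𝓕.F i : Set G) \ ((· * g) '' (𝓕.F i : Set G))).ncard : ℝ) / ((𝓕.F i).card : ℝ)
  let b : 𝓕.ι → ℝ := fun i ↦ (1 + ∑ t ∈ M ∪ Ω, a t i) * d - ((Ω.card : ℝ) ^ 2)⁻¹
  have hlim : Tendsto b atTop (𝓝 (d - ((Ω.card : ℝ) ^ 2)⁻¹)) := by
    have h1 : Tendsto (fun i ↦ ∑ t ∈ M ∪ Ω, a t i) atTop (𝓝 (∑ t ∈ M ∪ Ω, (0 : ℝ))) :=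
      tendsto_finsetSum _ fun t _ ↦ 𝓕.folner t
    simpa using ((h1.const_add 1).mul_const (d : ℝ)).sub_const (((Ω.card : ℝ) ^ 2)⁻¹)
  have hΩ0 : (0 : ℝ) < (Ω.card : ℝ) ^ 2 := by
    have := hΩ.card_pos
    positivity
  have hbound (i : 𝓕.ι) : dimE (cfgDim K V ↥(𝓕.F i) (restr K V (Set.range τ) (𝓕.F i))) *
      ((((𝓕.F i).card : ℝ)⁻¹ : ℝ) : EReal) ≤ ((b i : ℝ) : EReal) := by
    obtain ⟨E, hFE, hE⟩ := exists_finset_mul_card_le (𝓕.F i) (M ∪ Ω)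
    obtain ⟨J, hJF, hJ, hJc⟩ := exists_disjoint_translates (𝓕.F i) Ω hΩ
    obtain ⟨hJE, hle⟩ := cfgDim_restr_range_le hτ hHc hne hH hJ
      (fun g hg m hm ↦ hFE g hg m (Finset.mem_union_left _ hm))
      (fun g hg m hm ↦ hFE g (hJF hg) m (Finset.mem_union_right _ hm))
    have hF0 : (0 : ℝ) < (𝓕.F i).card := by exact_mod_cast (𝓕.nonempty i).card_pos
    refine (mul_le_mul_of_nonneg_right (dimE_le_coe hle)
      (by exact_mod_cast (inv_pos.mpr hF0).le)).trans ?_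
    rw [← EReal.coe_mul, EReal.coe_le_coe_iff, ← div_eq_mul_inv, div_le_iff₀ hF0]
    have hbF : b i * (𝓕.F i).card = ((𝓕.F i).card + ∑ t ∈ M ∪ Ω,
        (((𝓕.F i : Set G) \ ((· * t) '' (𝓕.F i : Set G))).ncard : ℝ)) * d -
        (𝓕.F i).card / (Ω.card : ℝ) ^ 2 := by
      simp only [b, a, ← Finset.sum_div]
      field_simp
    have hE' : (E.card : ℝ) ≤ (𝓕.F i).card + ∑ t ∈ M ∪ Ω,
        (((𝓕.F i : Set G) \ ((· * t) '' (𝓕.F i : Set G))).ncard : ℝ) := by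
      exact_mod_cast hE
    have hJ' : (𝓕.F i).card / (Ω.card : ℝ) ^ 2 ≤ J.card := by
      rw [div_le_iff₀ hΩ0]
      exact_mod_cast hJc
    rw [hbF, Nat.cast_sub hJE, Nat.cast_mul]
    exact sub_le_sub (mul_le_mul_of_nonneg_right hE' d.cast_nonneg) hJ'
  refine (limsup_le_limsup (Eventually.of_forall hbound)).trans_lt ?_
  have hlim' : Tendsto (fun i ↦ ((b i : ℝ) : EReal)) atTop _ :=
    (continuous_coe_real_ereal.tendsto _).comp hlim
  rw [hlim'.limsup_eq, EReal.coe_lt_coe_iff]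
  exact sub_lt_self _ (inv_pos.mpr hΩ0)

/-- Proposition 6.7. Let `G` be an amenable group with a Følner net
`𝓕`, `X` an irreducible algebraic variety over an algebraically closed field `K`,
`A := X(K)`, and `τ` an algebraic cellular automaton over `(G,X,K)`. If
`mdim_𝓕(τ(A^G)) = dim X`, then `τ` is `(*)`-pre-injective. -/
theorem starPreInjective_of_maximal_mdim
    (G : Type) [Group G] (𝓕 : FolnerNet G)
    (K : Type) [Field K] [IsAlgClosed K]
    (V : Over (SpecK K)) (hft : LocallyOfFiniteType V.hom) (hqc : QuasiCompact V.hom)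
    (hirr : IrreducibleSpace V.left)
    (τ : (G → Pt K V) → (G → Pt K V)) (hca : IsAlgCA K V τ)
    (hmdim : mdim K V 𝓕 (Set.range τ) = dimE (vdim K V)) :
    StarPreInjective K V τ := by
  rintro ⟨Ω, H, hHc, hne, hH⟩
  obtain ⟨M, f, hτ⟩ := hca
  have hΩ : Ω.Nonempty := by
    by_contra hΩ
    rw [Finset.not_nonempty_iff_eq_empty] at hΩ
    subst hΩ
    obtain ⟨a, -⟩ := exists_ev_mem V isOpen_univ Set.univ_nonempty
    have h1 : τ (fun _ ↦ a) ∈ τ '' cyl K V ∅ H fun _ ↦ a := by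
      rw [← hH]
      exact ⟨_, ⟨trivial, fun _ _ ↦ rfl⟩, rfl⟩
    obtain ⟨c, ⟨hc, -⟩, -⟩ := h1
    refine hne (Set.eq_univ_of_forall fun u ↦ ?_)
    convert hc using 1
    exact funext fun ω ↦ absurd ω.2 (Finset.notMem_empty _)
  have h1 := 𝓕.mdim_lt_genRank hτ hΩ hHc hne hH
  rw [hmdim] at h1
  exact h1.not_ge (coe_le_dimE genRank_le_vdim)

end GOE
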